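/- A positive definite integral binary quadratic form L is strongly s-regular if and only if L is almost strongly s-regular with respect to some finite set of primes. -/

import Mathlib

open Finset

/-- The value of the binary quadratic form `a x² + b x y + c y²`. -/
def bVal (a b c x y : ℤ) : ℤ := a * x ^ 2 + b * x * y + c * y ^ 2

/-- Positive definiteness of a binary quadratic form. -/
def bPosDef (a b c : ℤ) : Prop := ∀ x y : ℤ, ¬(x = 0 ∧ y = 0) → 0 < bVal a b c x y

/-- The number of representations of `n` by the binary form `a x² + b x y + c y²`. -/
noncomputable def bRep (a b c : ℤ) (n : ℤ) : ℕ :=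
  Set.ncard {v : ℤ × ℤ | bVal a b c v.1 v.2 = n}

/-- The discriminant `4ac - b²` of a binary quadratic form. -/
def bDisc (a b c : ℤ) : ℤ := 4 * a * c - b ^ 2

/-- The local factor `h_p(d, μ) = ∑_{t=0}^{2μ} χ(p)^t` with `χ(p) = (-d | p)` for binary forms. -/
def bHp (d : ℤ) (p : ℕ) (μ : ℕ) : ℤ :=
  ∑ t ∈ Finset.range (2 * μ + 1), (jacobiSym (-d) p) ^ t

/-- Almost strong s-regularity of a binary form with respect to a finite set `P` of primes. -/
def bASSR (a b c : ℤ) (P : Finset ℕ) : Prop :=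
  ∀ n₁ n₂ : ℕ, 0 < n₁ → 0 < n₂ →
    (∀ p : ℕ, p.Prime → p ∣ n₁ → p ∈ P ∨ (p : ℤ) ∣ 2 * bDisc a b c) →
    IsCoprime (n₂ : ℤ) (2 * bDisc a b c) → (∀ p ∈ P, ¬ p ∣ n₂) →
    (bRep a b c (((n₁ : ℤ) * (n₂ : ℤ)) ^ 2) : ℤ) =
      (bRep a b c ((n₁ : ℤ) ^ 2) : ℤ) *
        ∏ p ∈ n₂.primeFactors, bHp (bDisc a b c) p (n₂.factorization p)

/-- The minimum of positive integers `n` such that `n²` is represented by the binary form. -/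
noncomputable def bMs (a b c : ℤ) : ℕ :=
  sInf {n : ℕ | 0 < n ∧ bRep a b c ((n : ℤ) ^ 2) ≠ 0}

/-- The action of `X + Y ω` on `ℤ²`, where `ω² = b ω - a c`. -/
def bAct (a b c X Y : ℤ) (v : ℤ × ℤ) : ℤ × ℤ :=
  (X * v.1 - c * Y * v.2, a * Y * v.1 + (X + b * Y) * v.2)

/-- The norm of `X + Y ω`, where `ω² = b ω - a c`. -/
def bNorm (a b c X Y : ℤ) : ℤ := X ^ 2 + b * X * Y + a * c * Y ^ 2

theorem bVal_bAct (a b c X Y : ℤ) (v : ℤ × ℤ) :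
    bVal a b c (bAct a b c X Y v).1 (bAct a b c X Y v).2 =
      bNorm a b c X Y * bVal a b c v.1 v.2 := by
  simp only [bVal, bAct, bNorm]; ring

theorem bNorm_conj (a b c X Y : ℤ) : bNorm a b c (X + b * Y) (-Y) = bNorm a b c X Y := by
  simp only [bNorm]; ring

theorem bAct_conj_bAct (a b c X Y : ℤ) (v : ℤ × ℤ) :
    bAct a b c (X + b * Y) (-Y) (bAct a b c X Y v) =
      (bNorm a b c X Y * v.1, bNorm a b c X Y * v.2) := by
  simp only [bAct, bNorm]; ext <;> ring

theorem bAct_bAct_conj (a b c X Y : ℤ) (v : ℤ × ℤ) :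
    bAct a b c X Y (bAct a b c (X + b * Y) (-Y) v) =
      (bNorm a b c X Y * v.1, bNorm a b c X Y * v.2) := by
  simp only [bAct, bNorm]; ext <;> ring

theorem bAct_injective {a b c X Y : ℤ} (h : bNorm a b c X Y ≠ 0) :
    Function.Injective (bAct a b c X Y) := by
  intro v w hvw
  have := congrArg (bAct a b c (X + b * Y) (-Y)) hvw
  rw [bAct_conj_bAct, bAct_conj_bAct, Prod.mk.injEq] at this
  exact Prod.ext (mul_left_cancel₀ h this.1) (mul_left_cancel₀ h this.2)

theorem bPosDef.a_pos {a b c : ℤ} (h : bPosDef a b c) : 0 < a := by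
  simpa [bVal] using h 1 0 (by simp)

theorem bPosDef.c_pos {a b c : ℤ} (h : bPosDef a b c) : 0 < c := by
  simpa [bVal] using h 0 1 (by simp)

theorem bPosDef.bDisc_pos {a b c : ℤ} (h : bPosDef a b c) : 0 < bDisc a b c := by
  have ha := h.a_pos
  have h1 := h b (-2 * a) (by rintro ⟨-, h2⟩; omega)
  have h2 : bVal a b c b (-2 * a) = a * bDisc a b c := by simp only [bVal, bDisc]; ring
  rw [h2] at h1
  exact pos_of_mul_pos_right h1 ha.le

theorem bPosDef.finite_setOf_eq {a b c : ℤ} (h : bPosDef a b c) (n : ℤ) :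
    {v : ℤ × ℤ | bVal a b c v.1 v.2 = n}.Finite := by
  have ha := h.a_pos
  have hc := h.c_pos
  have hd := h.bDisc_pos
  refine ((Set.finite_Icc (-(4 * c * n)) (4 * c * n)).prod
    (Set.finite_Icc (-(4 * a * n)) (4 * a * n))).subset ?_
  rintro ⟨x, y⟩ hv
  have hv : bVal a b c x y = n := hv
  have h1 : 4 * c * n = (2 * c * y + b * x) ^ 2 + bDisc a b c * x ^ 2 := by
    rw [← hv]; simp only [bVal, bDisc]; ring
  have h2 : 4 * a * n = (2 * a * x + b * y) ^ 2 + bDisc a b c * y ^ 2 := by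
    rw [← hv]; simp only [bVal, bDisc]; ring
  have hx : x ^ 2 ≤ 4 * c * n := by nlinarith [sq_nonneg x, sq_nonneg (2 * c * y + b * x)]
  have hy : y ^ 2 ≤ 4 * a * n := by nlinarith [sq_nonneg y, sq_nonneg (2 * a * x + b * y)]
  have key : ∀ z : ℤ, |z| ≤ z ^ 2 := fun z => by
    rw [← sq_abs]
    rcases (abs_nonneg z).eq_or_lt with h0 | h0
    · rw [← h0]; norm_num
    · nlinarith
  exact ⟨abs_le.mp ((key x).trans hx), abs_le.mp ((key y).trans hy)⟩

/-- The vectors representing `n` that are not divisible by `q`. -/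
def bPrim (a b c q n : ℤ) : Set (ℤ × ℤ) :=
  {v | bVal a b c v.1 v.2 = n ∧ ¬(q ∣ v.1 ∧ q ∣ v.2)}

theorem bPosDef.finite_bPrim {a b c : ℤ} (h : bPosDef a b c) (q n : ℤ) :
    (bPrim a b c q n).Finite :=
  (h.finite_setOf_eq n).subset fun _ hv => hv.1

theorem bRep_sq_mul {a b c : ℤ} (h : bPosDef a b c) {q : ℤ} (hq : q ≠ 0) (n : ℤ) :
    bRep a b c (q ^ 2 * n) = (bPrim a b c q (q ^ 2 * n)).ncard + bRep a b c n := by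
  have hinj : Function.Injective fun v : ℤ × ℤ => (q * v.1, q * v.2) := by
    intro v w hvw
    rw [Prod.mk.injEq] at hvw
    exact Prod.ext (mul_left_cancel₀ hq hvw.1) (mul_left_cancel₀ hq hvw.2)
  have hval : ∀ x y : ℤ, bVal a b c (q * x) (q * y) = q ^ 2 * bVal a b c x y := fun x y => by
    simp only [bVal]; ring
  have himg : {v : ℤ × ℤ | bVal a b c v.1 v.2 = q ^ 2 * n} =
      bPrim a b c q (q ^ 2 * n) ∪
        (fun v : ℤ × ℤ => (q * v.1, q * v.2)) '' {v | bVal a b c v.1 v.2 = n} := by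
    ext ⟨x, y⟩
    simp only [bPrim, Set.mem_ofPred_eq, Set.mem_union, Set.mem_image, Prod.mk.injEq, Prod.exists]
    constructor
    · intro hv
      by_cases hd : q ∣ x ∧ q ∣ y
      · obtain ⟨⟨x', rfl⟩, ⟨y', rfl⟩⟩ := hd
        rw [hval] at hv
        exact Or.inr ⟨x', y', mul_left_cancel₀ (pow_ne_zero 2 hq) hv, rfl, rfl⟩
      · exact Or.inl ⟨hv, hd⟩
    · rintro (hv | ⟨x', y', hv, rfl, rfl⟩)
      · exact hv.1
      · rw [hval, hv]
  have hdisj : Disjoint (bPrim a b c q (q ^ 2 * n))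
      ((fun v : ℤ × ℤ => (q * v.1, q * v.2)) '' {v | bVal a b c v.1 v.2 = n}) := by
    rw [Set.disjoint_left]
    rintro _ hv ⟨w, -, rfl⟩
    exact hv.2 ⟨dvd_mul_right _ _, dvd_mul_right _ _⟩
  rw [bRep, himg, Set.ncard_union_eq hdisj (h.finite_bPrim _ _)
    ((h.finite_setOf_eq n).image _), Set.ncard_image_of_injective _ hinj, bRep]

/-- A vector not divisible by `q` whose value is divisible by `q ^ k` is annihilated modulo `q ^ k`
by one of two conjugate elements of norm divisible by `q ^ k` and trace prime to `q`. -/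
theorem dvd_bAct_or_dvd_bAct_conj {a b c q X Y : ℤ} {k : ℕ} (hq : Prime q)
    (hN : q ^ k ∣ bNorm a b c X Y) (htr : ¬ q ∣ 2 * X + b * Y) {v : ℤ × ℤ}
    (hv : q ^ k ∣ bVal a b c v.1 v.2) (hp : ¬(q ∣ v.1 ∧ q ∣ v.2)) :
    (q ^ k ∣ (bAct a b c X Y v).1 ∧ q ^ k ∣ (bAct a b c X Y v).2) ∨
      (q ^ k ∣ (bAct a b c (X + b * Y) (-Y) v).1 ∧
        q ^ k ∣ (bAct a b c (X + b * Y) (-Y) v).2) := by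
  set s := (bAct a b c X Y v).1 with hs
  set t := (bAct a b c X Y v).2 with ht
  set s' := (bAct a b c (X + b * Y) (-Y) v).1 with hs'
  set t' := (bAct a b c (X + b * Y) (-Y) v).2 with ht'
  have e1 : s + s' = (2 * X + b * Y) * v.1 := by simp only [hs, hs', bAct]; ring
  have e2 : t + t' = (2 * X + b * Y) * v.2 := by simp only [ht, ht', bAct]; ring
  have d11 : q ^ k ∣ s * s' := by
    have : s * s' = bNorm a b c X Y * v.1 ^ 2 - c * Y ^ 2 * bVal a b c v.1 v.2 := by
      simp only [hs, hs', bAct, bNorm, bVal]; ring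
    rw [this]; exact dvd_sub (hN.mul_right _) (hv.mul_left _)
  have d22 : q ^ k ∣ t * t' := by
    have : t * t' = bNorm a b c X Y * v.2 ^ 2 - a * Y ^ 2 * bVal a b c v.1 v.2 := by
      simp only [ht, ht', bAct, bNorm, bVal]; ring
    rw [this]; exact dvd_sub (hN.mul_right _) (hv.mul_left _)
  have d12 : q ^ k ∣ s * t' := by
    have : s * t' = bNorm a b c X Y * (v.1 * v.2) - X * Y * bVal a b c v.1 v.2 := by
      simp only [hs, ht', bAct, bNorm, bVal]; ring
    rw [this]; exact dvd_sub (hN.mul_right _) (hv.mul_left _)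
  have d21 : q ^ k ∣ t * s' := by
    have : t * s' = bNorm a b c X Y * (v.1 * v.2) + (X + b * Y) * Y * bVal a b c v.1 v.2 := by
      simp only [ht, hs', bAct, bNorm, bVal]; ring
    rw [this]; exact dvd_add (hN.mul_right _) (hv.mul_left _)
  have cancel : ∀ {x y : ℤ}, q ^ k ∣ x * y → ¬ q ∣ y → q ^ k ∣ x := fun hxy hy =>
    hq.pow_dvd_of_dvd_mul_right k hy hxy
  have cancel' : ∀ {x y : ℤ}, q ^ k ∣ x * y → ¬ q ∣ x → q ^ k ∣ y := fun hxy hy =>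
    hq.pow_dvd_of_dvd_mul_left k hy hxy
  have hunit : ¬ q ∣ s + s' ∨ ¬ q ∣ t + t' := by
    rw [e1, e2, hq.dvd_mul, hq.dvd_mul]; tauto
  by_cases h1 : q ∣ s'
  · by_cases h2 : q ∣ t'
    · right
      rcases hunit with h | h
      · have h3 : ¬ q ∣ s := fun h3 => h (dvd_add h3 h1)
        exact ⟨cancel' d11 h3, cancel' d12 h3⟩
      · have h3 : ¬ q ∣ t := fun h3 => h (dvd_add h3 h2)
        exact ⟨cancel' d21 h3, cancel' d22 h3⟩
    · exact Or.inl ⟨cancel d12 h2, cancel d22 h2⟩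
  · exact Or.inl ⟨cancel d11 h1, cancel d21 h1⟩

theorem ncard_dvd_bAct_le {a b c q n X Y : ℤ} {μ : ℕ} (h : bPosDef a b c) (hq : q ≠ 0)
    (hn : n ≠ 0) (hN : bNorm a b c X Y = (q ^ μ * n) ^ 2) (M : ℤ) :
    {v : ℤ × ℤ | bVal a b c v.1 v.2 = (q ^ μ) ^ 2 * M ∧ q ^ (2 * μ) ∣ (bAct a b c X Y v).1 ∧
      q ^ (2 * μ) ∣ (bAct a b c X Y v).2}.ncard ≤ bRep a b c (n ^ 2 * M) := by
  have hq' : q ^ (2 * μ) ≠ 0 := pow_ne_zero _ hq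
  have hN0 : bNorm a b c X Y ≠ 0 := by rw [hN]; positivity
  refine Set.ncard_le_ncard_of_injOn
    (fun v => ((bAct a b c X Y v).1 / q ^ (2 * μ), (bAct a b c X Y v).2 / q ^ (2 * μ))) ?_ ?_
    (h.finite_setOf_eq _)
  · rintro v ⟨hv, ⟨s, hs⟩, ⟨t, ht⟩⟩
    simp only [Set.mem_ofPred_eq]
    have h1 := bVal_bAct a b c X Y v
    rw [hs, ht, hv, hN] at h1
    rw [hs, ht, Int.mul_ediv_cancel_left _ hq', Int.mul_ediv_cancel_left _ hq']
    apply mul_left_cancel₀ (pow_ne_zero 2 hq')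
    calc (q ^ (2 * μ)) ^ 2 * bVal a b c s t
        = bVal a b c (q ^ (2 * μ) * s) (q ^ (2 * μ) * t) := by simp only [bVal]; ring
      _ = _ := by rw [h1]; ring
  · rintro v ⟨-, hv1, hv2⟩ w ⟨-, hw1, hw2⟩ hvw
    rw [Prod.mk.injEq] at hvw
    exact bAct_injective hN0 (Prod.ext ((Int.ediv_left_inj hv1 hw1).mp hvw.1)
      ((Int.ediv_left_inj hv2 hw2).mp hvw.2))

theorem ncard_bPrim_le {a b c q n X Y : ℤ} {μ : ℕ} (h : bPosDef a b c) (hq : Prime q)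
    (hn : n ≠ 0) (hN : bNorm a b c X Y = (q ^ μ * n) ^ 2) (htr : ¬ q ∣ 2 * X + b * Y) (M : ℤ) :
    (bPrim a b c q ((q ^ μ) ^ 2 * M)).ncard ≤ 2 * bRep a b c (n ^ 2 * M) := by
  have h1 := ncard_dvd_bAct_le h hq.ne_zero hn hN M
  have h2 := ncard_dvd_bAct_le h hq.ne_zero hn ((bNorm_conj a b c X Y).trans hN) M
  rw [two_mul]
  refine le_trans ?_ ((Set.ncard_union_le _ _).trans (add_le_add h1 h2))
  refine Set.ncard_le_ncard ?_ ((h.finite_setOf_eq ((q ^ μ) ^ 2 * M)).subset ?_)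
  · rintro v ⟨hv, hp⟩
    have hN' : q ^ (2 * μ) ∣ bNorm a b c X Y := ⟨n ^ 2, by rw [hN]; ring⟩
    have hv' : q ^ (2 * μ) ∣ bVal a b c v.1 v.2 := ⟨M, by rw [hv]; ring⟩
    rcases dvd_bAct_or_dvd_bAct_conj hq hN' htr hv' hp with h3 | h3
    · exact Or.inl ⟨hv, h3⟩
    · exact Or.inr ⟨hv, h3⟩
  · rintro v (hv | hv) <;> exact hv.1

theorem bAct_not_dvd {a b c q X Y : ℤ} (hq : Prime q) (hN : q ∣ bNorm a b c X Y)
    (htr : ¬ q ∣ 2 * X + b * Y) {v : ℤ × ℤ} (hv : ¬ q ∣ bVal a b c v.1 v.2) :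
    ¬(q ∣ (bAct a b c X Y v).1 ∧ q ∣ (bAct a b c X Y v).2) := by
  rintro ⟨h1, h2⟩
  have hY : ¬ q ∣ Y := by
    intro hY
    apply htr
    apply hq.dvd_of_dvd_pow (n := 2)
    have : (2 * X + b * Y) ^ 2 = 4 * bNorm a b c X Y + (b ^ 2 - 4 * a * c) * Y * Y := by
      simp only [bNorm]; ring
    rw [this]
    exact dvd_add (hN.mul_left _) (hY.mul_left _)
  have : (2 * X + b * Y) * Y * bVal a b c v.1 v.2 =
      (bAct a b c X Y v).2 * (bAct a b c (X + b * Y) (-Y) v).1 -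
        (bAct a b c X Y v).1 * (bAct a b c (X + b * Y) (-Y) v).2 := by
    simp only [bAct, bVal]; ring
  have h3 : q ∣ (2 * X + b * Y) * Y * bVal a b c v.1 v.2 := by
    rw [this]; exact dvd_sub (h2.mul_right _) (h1.mul_right _)
  rw [hq.dvd_mul, hq.dvd_mul] at h3
  tauto

theorem two_mul_bRep_le_ncard_bPrim {a b c q n X Y : ℤ} {μ : ℕ} (h : bPosDef a b c)
    (hq : Prime q) (hn : n ≠ 0) (hμ : μ ≠ 0) (hN : bNorm a b c X Y = (q ^ μ * n) ^ 2)
    (htr : ¬ q ∣ 2 * X + b * Y) {M : ℤ} (hM : ¬ q ∣ M) :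
    2 * bRep a b c M ≤ (bPrim a b c q ((q ^ μ) ^ 2 * (n ^ 2 * M))).ncard := by
  have hq0 := hq.ne_zero
  have hN0 : bNorm a b c X Y ≠ 0 := by rw [hN]; positivity
  have hqN : q ∣ bNorm a b c X Y := by
    rw [hN]; exact ((dvd_pow_self q hμ).mul_right n).trans (dvd_pow_self _ two_ne_zero)
  have hN' := bNorm_conj a b c X Y
  have htr' : ¬ q ∣ 2 * (X + b * Y) + b * -Y := by
    convert htr using 2; ring
  set S : Set (ℤ × ℤ) := {v | bVal a b c v.1 v.2 = M} with hS
  have hdisj : Disjoint (bAct a b c X Y '' S) (bAct a b c (X + b * Y) (-Y) '' S) := by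
    rw [Set.disjoint_left]
    rintro _ ⟨v, hv, rfl⟩ ⟨w, -, hw⟩
    have hv : bVal a b c v.1 v.2 = M := hv
    refine bAct_not_dvd hq hqN htr (hv ▸ hM) ?_
    have e1 := bAct_conj_bAct a b c X Y v
    have e2 := bAct_bAct_conj a b c X Y w
    rw [hw] at e2
    set z := bAct a b c X Y v
    have f1 : (2 * X + b * Y) * z.1 = bNorm a b c X Y * (v.1 + w.1) := by
      have g1 := congrArg Prod.fst e1
      have g2 := congrArg Prod.fst e2
      simp only [bAct] at g1 g2
      linear_combination g1 + g2
    have f2 : (2 * X + b * Y) * z.2 = bNorm a b c X Y * (v.2 + w.2) := by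
      have g1 := congrArg Prod.snd e1
      have g2 := congrArg Prod.snd e2
      simp only [bAct] at g1 g2
      linear_combination g1 + g2
    exact ⟨(hq.dvd_or_dvd (f1 ▸ hqN.mul_right _)).resolve_left htr,
      (hq.dvd_or_dvd (f2 ▸ hqN.mul_right _)).resolve_left htr⟩
  have hfin : S.Finite := h.finite_setOf_eq M
  have hcard : 2 * bRep a b c M =
      (bAct a b c X Y '' S ∪ bAct a b c (X + b * Y) (-Y) '' S).ncard := by
    rw [Set.ncard_union_eq hdisj (hfin.image _) (hfin.image _),
      Set.ncard_image_of_injective _ (bAct_injective hN0),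
      Set.ncard_image_of_injective _ (bAct_injective (hN' ▸ hN0)), bRep, two_mul]
  rw [hcard]
  refine Set.ncard_le_ncard ?_ (h.finite_bPrim _ _)
  rintro _ (⟨v, hv, rfl⟩ | ⟨v, hv, rfl⟩)
  · have hv : bVal a b c v.1 v.2 = M := hv
    refine ⟨?_, bAct_not_dvd hq hqN htr (hv ▸ hM)⟩
    rw [bVal_bAct, hv, hN]; ring
  · have hv : bVal a b c v.1 v.2 = M := hv
    refine ⟨?_, bAct_not_dvd hq (hN' ▸ hqN) htr' (hv ▸ hM)⟩
    rw [bVal_bAct, hv, hN', hN]; ring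

theorem bHp_eq (d : ℤ) (p μ : ℕ) :
    bHp d p μ = if jacobiSym (-d) p = 1 then 2 * (μ : ℤ) + 1 else 1 := by
  unfold bHp
  rcases jacobiSym.trichotomy (-d) p with h | h | h
  · rw [h, if_neg (by norm_num), Finset.sum_range_succ', Finset.sum_eq_zero]
    · simp
    · intro i _; exact zero_pow (Nat.succ_ne_zero i)
  · simp [h]
  · rw [h, if_neg (by norm_num)]
    induction μ with
    | zero => simp
    | succ k ih =>
      rw [show 2 * (k + 1) + 1 = 2 * k + 1 + 1 + 1 by ring, Finset.sum_range_succ,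
        Finset.sum_range_succ, ih]
      ring

/-- A power `(q ^ μ * n) ^ 2`, with `n` prime to `B` and to `q`, is the norm of an element
of trace prime to `q`, when `q` splits. -/
theorem exists_bNorm_eq {a b c : ℤ} (h : bPosDef a b c) {q : ℕ} (hq : q.Prime)
    (hqd : ¬ (q : ℤ) ∣ 2 * bDisc a b c) (hχ : jacobiSym (-bDisc a b c) q = 1)
    {B : ℤ} (hB : B ≠ 0) (hqB : ¬ (q : ℤ) ∣ B) (μ : ℕ) :
    ∃ (X Y : ℤ) (n : ℕ), 0 < n ∧ bNorm a b c X Y = ((q : ℤ) ^ μ * n) ^ 2 ∧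
      ¬ (q : ℤ) ∣ 2 * X + b * Y ∧ IsCoprime (n : ℤ) B ∧ ¬ q ∣ n := by
  have hqp : Prime (q : ℤ) := Nat.prime_iff_prime_int.mp hq
  have hq2 : ¬ (q : ℤ) ∣ 2 := fun h2 => hqd (h2.mul_right _)
  have hd0 : ¬ (q : ℤ) ∣ bDisc a b c := fun h2 => hqd (h2.mul_left _)
  have cop : ∀ {z : ℤ}, ¬ (q : ℤ) ∣ z → IsCoprime (q : ℤ) z := fun hz =>
    (hqp.coprime_iff_not_dvd).mpr hz
  -- a square root of the discriminant modulo `q`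
  obtain ⟨r, hr⟩ : ∃ r : ℤ, (q : ℤ) ∣ r ^ 2 + bDisc a b c := by
    have := Fact.mk hq
    rw [← jacobiSym.legendreSym.to_jacobiSym] at hχ
    have hne : ((-bDisc a b c : ℤ) : ZMod q) ≠ 0 := by
      rw [Ne, ZMod.intCast_zmod_eq_zero_iff_dvd]
      simpa using hd0
    obtain ⟨s, hs⟩ := (legendreSym.eq_one_iff q hne).mp hχ
    refine ⟨s.val, ?_⟩
    rw [← ZMod.intCast_zmod_eq_zero_iff_dvd]
    push_cast at hs ⊢
    rw [ZMod.natCast_zmod_val]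
    linear_combination -hs
  have hr0 : ¬ (q : ℤ) ∣ r := fun h1 =>
    hd0 ((dvd_add_right (h1.trans (dvd_pow_self r two_ne_zero))).mp hr)
  obtain ⟨u, w, huw⟩ := cop hq2
  -- a simple root modulo `q`
  have hroot : ∃ x0 : ℤ, (q : ℤ) ∣ bNorm a b c x0 B ∧ ¬ (q : ℤ) ∣ 2 * x0 + b * B := by
    have e1 : 2 * (w * (r - b) * B) + b * B = r * B - q * (u * (r - b) * B) := by
      linear_combination ((r - b) * B) * huw
    refine ⟨w * (r - b) * B, ?_, ?_⟩
    · have e2 : 4 * bNorm a b c (w * (r - b) * B) B =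
          (2 * (w * (r - b) * B) + b * B) ^ 2 + bDisc a b c * B ^ 2 := by
        simp only [bNorm, bDisc]; ring
      rw [e1] at e2
      have e3 : (q : ℤ) ∣ 4 * bNorm a b c (w * (r - b) * B) B := by
        obtain ⟨k, hk⟩ := hr
        rw [e2]
        refine ⟨k * B ^ 2 - 2 * r * B * (u * (r - b) * B) + q * (u * (r - b) * B) ^ 2, ?_⟩
        linear_combination B ^ 2 * hk
      have h4 : ¬ (q : ℤ) ∣ 4 := by
        intro h4
        rw [show (4 : ℤ) = 2 * 2 by norm_num, hqp.dvd_mul] at h4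
        tauto
      exact (hqp.dvd_or_dvd e3).resolve_left h4
    · rw [e1]
      intro h5
      have := (dvd_sub_left (dvd_mul_right (q : ℤ) _)).mp h5
      rw [hqp.dvd_mul] at this
      tauto
  obtain ⟨x0, hx0, hx0'⟩ := hroot
  -- a root of valuation exactly one
  obtain ⟨x1, hx1, hx1', hx1''⟩ : ∃ x1 : ℤ, (q : ℤ) ∣ bNorm a b c x1 B ∧
      ¬ (q : ℤ) ∣ 2 * x1 + b * B ∧ ¬ (q : ℤ) ^ 2 ∣ bNorm a b c x1 B := by
    by_cases h2 : (q : ℤ) ^ 2 ∣ bNorm a b c x0 B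
    · have e : bNorm a b c (x0 + q) B = bNorm a b c x0 B + q * (2 * x0 + b * B + q) := by
        simp only [bNorm]; ring
      refine ⟨x0 + q, ?_, ?_, ?_⟩
      · rw [e]; exact dvd_add hx0 (dvd_mul_right _ _)
      · intro h3
        apply hx0'
        have : 2 * x0 + b * B = (2 * (x0 + q) + b * B) - q * 2 := by ring
        rw [this]; exact dvd_sub h3 (dvd_mul_right _ _)
      · rw [e]
        intro h3
        have h4 := (dvd_add_right h2).mp h3
        rw [pow_two] at h4
        have h5 := (mul_dvd_mul_iff_left hqp.ne_zero).mp h4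
        exact hx0' ((dvd_add_left (dvd_refl _)).mp h5)
    · exact ⟨x0, hx0, hx0', h2⟩
  obtain ⟨s, t, hst⟩ := (cop hqB).pow_left (m := 2)
  -- solve `x ≡ x1 [q ^ 2]`, `x ≡ 1 [B]`
  obtain ⟨x, hxq, hxB⟩ : ∃ x : ℤ, (q : ℤ) ^ 2 ∣ x - x1 ∧ B ∣ x - 1 :=
    ⟨x1 * t * B + s * q ^ 2,
      ⟨s * (1 - x1), by linear_combination x1 * hst⟩,
      ⟨(x1 - 1) * t, by linear_combination hst⟩⟩
  have hdiff : ∀ x x' : ℤ, bNorm a b c x B - bNorm a b c x' B = (x - x') * (x + x' + b * B) :=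
    fun x x' => by simp only [bNorm]; ring
  have hd2 : (q : ℤ) ^ 2 ∣ bNorm a b c x B - bNorm a b c x1 B := by
    rw [hdiff]; exact hxq.mul_right _
  have hxN : (q : ℤ) ∣ bNorm a b c x B :=
    (dvd_iff_dvd_of_dvd_sub ((dvd_pow_self _ two_ne_zero).trans hd2)).mpr hx1
  have hxN2 : ¬ (q : ℤ) ^ 2 ∣ bNorm a b c x B := fun h3 =>
    hx1'' ((dvd_iff_dvd_of_dvd_sub hd2).mp h3)
  have hxtr : ¬ (q : ℤ) ∣ 2 * x + b * B := by
    intro h3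
    apply hx1'
    have : 2 * x1 + b * B = (2 * x + b * B) - 2 * (x - x1) := by ring
    rw [this]
    exact dvd_sub h3 (((dvd_pow_self _ two_ne_zero).trans hxq).mul_left _)
  have hpos : 0 < bNorm a b c x B := by
    have e : 4 * bNorm a b c x B = (2 * x + b * B) ^ 2 + bDisc a b c * B ^ 2 := by
      simp only [bNorm, bDisc]; ring
    have := h.bDisc_pos
    have : 0 < bDisc a b c * B ^ 2 := by positivity
    nlinarith [sq_nonneg (2 * x + b * B)]
  obtain ⟨n', hn'⟩ := hxN
  have hn'pos : 0 < n' := by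
    rw [hn'] at hpos
    exact pos_of_mul_pos_right hpos (by positivity)
  lift n' to ℕ using hn'pos.le
  have hn'q : ¬ q ∣ n' := by
    rintro ⟨k, rfl⟩
    apply hxN2
    rw [hn']
    exact ⟨k, by push_cast; ring⟩
  have hn'B : IsCoprime (n' : ℤ) B := by
    have h1 : IsCoprime (bNorm a b c x B) B := by
      obtain ⟨k, hk⟩ := hxB
      refine ⟨1, -(k * (x + 1) + b * x + a * c * B), ?_⟩
      simp only [bNorm]
      linear_combination (x + 1) * hk
    rw [hn'] at h1
    exact h1.of_mul_left_right
  -- powers of `x + B ω`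
  have hpow : ∀ k : ℕ, ∃ X Y : ℤ, bNorm a b c X Y = bNorm a b c x B ^ (k + 1) ∧
      (q : ℤ) ∣ B * X - x * Y ∧ ¬ (q : ℤ) ∣ B * X + (x + b * B) * Y := by
    intro k
    induction k with
    | zero =>
      refine ⟨x, B, by ring, by rw [mul_comm]; simp, ?_⟩
      rw [show B * x + (x + b * B) * B = B * (2 * x + b * B) by ring, hqp.dvd_mul]
      tauto
    | succ k ih =>
      obtain ⟨X, Y, h1, h2, h3⟩ := ih
      refine ⟨x * X - a * c * B * Y, B * X + x * Y + b * B * Y, ?_, ?_, ?_⟩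
      · rw [pow_succ, ← h1]; simp only [bNorm]; ring
      · have e : B * (x * X - a * c * B * Y) - x * (B * X + x * Y + b * B * Y) =
            -(bNorm a b c x B * Y) := by simp only [bNorm]; ring
        rw [e, hn']
        exact ⟨-(n' * Y), by ring⟩
      · have e : B * (x * X - a * c * B * Y) + (x + b * B) * (B * X + x * Y + b * B * Y) =
            (2 * x + b * B) * (B * X + (x + b * B) * Y) - q * n' * Y := by
          rw [← hn']; simp only [bNorm]; ring
        rw [e]
        intro h4
        have h5 : (q : ℤ) ∣ q * n' * Y := ⟨n' * Y, by ring⟩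
        have h6 := (dvd_sub_left h5).mp h4
        rw [hqp.dvd_mul] at h6
        tauto
  rcases Nat.eq_zero_or_pos μ with rfl | hμ
  · exact ⟨1, 0, 1, one_pos, by simp [bNorm], by simpa using hq2, by simpa using isCoprime_one_left,
      fun h1 => hq.one_lt.ne' (Nat.dvd_one.mp h1)⟩
  obtain ⟨X, Y, h1, h2, h3⟩ := hpow (2 * μ - 1)
  refine ⟨X, Y, n' ^ μ, pow_pos (by exact_mod_cast hn'pos) μ, ?_, ?_, ?_, ?_⟩
  · rw [h1, hn', show 2 * μ - 1 + 1 = μ * 2 by omega, pow_mul, mul_pow]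
    push_cast; ring
  · intro h4
    apply h3
    have e : B * X + (x + b * B) * Y = B * (2 * X + b * Y) - (B * X - x * Y) := by ring
    rw [e]
    exact dvd_sub (h4.mul_left _) h2
  · push_cast; exact hn'B.pow_left
  · exact fun h4 => hn'q (hq.dvd_of_dvd_pow h4)

/-- The product of the local factors over the primes dividing `n`. -/
def bHprod (d : ℤ) (n : ℕ) : ℤ := ∏ p ∈ n.primeFactors, bHp d p (n.factorization p)

theorem bHp_pos (d : ℤ) (p μ : ℕ) : 0 < bHp d p μ := by
  rw [bHp_eq]; split_ifs <;> positivity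

theorem bHprod_pos (d : ℤ) (n : ℕ) : 0 < bHprod d n := Finset.prod_pos fun _ _ => bHp_pos _ _ _

theorem tendsto_bHprod_pow_ratio (d : ℤ) (n : ℕ) :
    Filter.Tendsto (fun T : ℕ => (bHprod d (n ^ (T + 1)) : ℝ) / bHprod d (n ^ T))
      Filter.atTop (nhds 1) := by
  have key : ∀ p ∈ n.primeFactors, Filter.Tendsto
      (fun T : ℕ => (bHp d p ((T + 1) * n.factorization p) : ℝ) / bHp d p (T * n.factorization p))
      Filter.atTop (nhds 1) := by
    intro p hp
    by_cases h1 : jacobiSym (-d) p = 1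
    · simp only [bHp_eq, h1, if_true]
      set e := n.factorization p with he
      have hT : Filter.Tendsto (fun T : ℕ => 1 + (2 * (e : ℝ)) / ((2 * e * T : ℝ) + 1))
          Filter.atTop (nhds (1 + 0)) := by
        refine tendsto_const_nhds.add ?_
        have he0 : (0 : ℝ) < 2 * e := by
          have : e ≠ 0 := by
            rw [he, ← Finsupp.mem_support_iff, Nat.support_factorization]; exact hp
          positivity
        exact Filter.Tendsto.const_div_atTop (Filter.tendsto_atTop_add_const_right _ _
          (tendsto_natCast_atTop_atTop.const_mul_atTop he0)) _
      rw [add_zero] at hT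
      refine hT.congr fun T => ?_
      have : (2 * (e : ℝ) * T + 1) ≠ 0 := by positivity
      push_cast
      rw [eq_div_iff (by positivity)]
      field_simp
      ring
    · simp only [bHp_eq, h1, if_false]
      simp
  have hprod := tendsto_finsetProd n.primeFactors key
  simp only [Finset.prod_const_one] at hprod
  refine hprod.congr' ?_
  filter_upwards [Filter.eventually_ge_atTop 1] with T hT
  rw [Finset.prod_div_distrib]
  have hf : ∀ k : ℕ, k ≠ 0 → (bHprod d (n ^ k) : ℝ) =
      ∏ p ∈ n.primeFactors, (bHp d p (k * n.factorization p) : ℝ) := by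
    intro k hk
    unfold bHprod
    rw [Nat.primeFactors_pow n hk, Nat.factorization_pow]
    push_cast
    simp
  rw [hf _ (by omega), hf _ (by omega)]

theorem le_of_forall_mul_bHprod_le {d : ℤ} {n : ℕ} {x y : ℤ}
    (h : ∀ T : ℕ, x * bHprod d (n ^ T) ≤ y * bHprod d (n ^ (T + 1))) : x ≤ y := by
  have h1 := (tendsto_bHprod_pow_ratio d n).const_mul (y : ℝ)
  rw [mul_one] at h1
  have h2 : (x : ℝ) ≤ y := ge_of_tendsto' h1 fun T => by
    have hp : (0 : ℝ) < bHprod d (n ^ T) := by exact_mod_cast bHprod_pos d (n ^ T)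
    rw [← mul_div_assoc, le_div_iff₀ hp]
    exact_mod_cast h T
  exact_mod_cast h2

theorem bPrim_eq_empty {a b c : ℤ} {q : ℕ} (hq : q.Prime)
    (hqd : ¬ (q : ℤ) ∣ 2 * bDisc a b c) (hχ : jacobiSym (-bDisc a b c) q ≠ 1) (n : ℤ)
    (hn : (q : ℤ) ∣ n) : bPrim a b c q n = ∅ := by
  have := Fact.mk hq
  have hd0 : ¬ (q : ℤ) ∣ bDisc a b c := fun h2 => hqd (h2.mul_left _)
  have hne : ((-bDisc a b c : ℤ) : ZMod q) ≠ 0 := by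
    rw [Ne, ZMod.intCast_zmod_eq_zero_iff_dvd]
    simpa using hd0
  rw [← jacobiSym.legendreSym.to_jacobiSym, Ne, legendreSym.eq_one_iff q hne] at hχ
  have key : ∀ s t : ℤ, (q : ℤ) ∣ s ^ 2 + bDisc a b c * t ^ 2 → (q : ℤ) ∣ t := by
    intro s t hst
    by_contra ht
    rw [← ZMod.intCast_zmod_eq_zero_iff_dvd] at hst ht
    refine hχ ⟨s / t, ?_⟩
    push_cast at hst ⊢
    field_simp
    linear_combination -hst
  rw [Set.eq_empty_iff_forall_notMem]
  rintro ⟨x, y⟩ ⟨hv, hp⟩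
  simp only at hv hp
  rw [← hv] at hn
  refine hp ⟨key (2 * c * y + b * x) x ?_, key (2 * a * x + b * y) y ?_⟩
  · have : (2 * c * y + b * x) ^ 2 + bDisc a b c * x ^ 2 = 4 * c * bVal a b c x y := by
      simp only [bVal, bDisc]; ring
    rw [this]; exact hn.mul_left _
  · have : (2 * a * x + b * y) ^ 2 + bDisc a b c * y ^ 2 = 4 * a * bVal a b c x y := by
      simp only [bVal, bDisc]; ring
    rw [this]; exact hn.mul_left _

theorem bASSR.bRep_mul_pow {a b c : ℤ} {P : Finset ℕ} (h : bPosDef a b c) (hP : ∀ p ∈ P, p.Prime)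
    (hreg : bASSR a b c P) {q : ℕ} (hqP : q ∈ P) (hqd : ¬ (q : ℤ) ∣ 2 * bDisc a b c) {m : ℕ}
    (hm : 0 < m) (hmP : ∀ p : ℕ, p.Prime → p ∣ m → p ∈ P ∨ (p : ℤ) ∣ 2 * bDisc a b c)
    (hqm : ¬ q ∣ m) (μ : ℕ) :
    (bRep a b c (((q : ℤ) ^ μ * m) ^ 2) : ℤ) =
      bRep a b c ((m : ℤ) ^ 2) * bHp (bDisc a b c) q μ := by
  have hq := hP q hqP
  have hqp : Prime (q : ℤ) := Nat.prime_iff_prime_int.mp hq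
  have hd := h.bDisc_pos
  rw [bHp_eq]
  have hsplit : ∀ (k : ℕ) (M : ℤ), bRep a b c (((q : ℤ) ^ (k + 1)) ^ 2 * M) =
      (bPrim a b c q (((q : ℤ) ^ (k + 1)) ^ 2 * M)).ncard +
        bRep a b c (((q : ℤ) ^ k) ^ 2 * M) := by
    intro k M
    have := bRep_sq_mul h hqp.ne_zero (((q : ℤ) ^ k) ^ 2 * M)
    rwa [show (q : ℤ) ^ 2 * (((q : ℤ) ^ k) ^ 2 * M) = ((q : ℤ) ^ (k + 1)) ^ 2 * M by ring] at this
  induction μ with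
  | zero => simp
  | succ k ih =>
    by_cases hχ : jacobiSym (-bDisc a b c) q = 1
    · rw [if_pos hχ] at ih ⊢
      set B : ℤ := 2 * bDisc a b c * ∏ p ∈ P.erase q, (p : ℤ) with hBdef
      have hB : B ≠ 0 := mul_ne_zero (by positivity) (Finset.prod_ne_zero_iff.mpr fun p hp => by
        exact_mod_cast (hP p (Finset.mem_of_mem_erase hp)).ne_zero)
      have hqB : ¬ (q : ℤ) ∣ B := by
        rw [hBdef, hqp.dvd_mul, hqp.dvd_finsetProd_iff]
        rintro (h1 | ⟨p, hp, h1⟩)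
        · exact hqd h1
        · have hp' := Finset.mem_erase.mp hp
          exact hp'.1 ((Nat.prime_dvd_prime_iff_eq hq (hP p hp'.2)).mp
            (Int.natCast_dvd_natCast.mp h1)).symm
      obtain ⟨X, Y, n, hn, hN, htr, hnB, hqn⟩ := exists_bNorm_eq h hq hqd hχ hB hqB (k + 1)
      have hn0 : (n : ℤ) ≠ 0 := by exact_mod_cast hn.ne'
      have hnd : IsCoprime (n : ℤ) (2 * bDisc a b c) := hnB.of_mul_right_left
      have hnP : ∀ T : ℕ, ∀ p ∈ P, ¬ p ∣ n ^ T := by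
        intro T p hp hpn
        have hpn := (hP p hp).dvd_of_dvd_pow hpn
        by_cases hpq : p = q
        · exact hqn (hpq ▸ hpn)
        · have h1 : (p : ℤ) ∣ B :=
            (Finset.dvd_prod_of_mem (fun p : ℕ => (p : ℤ))
              (Finset.mem_erase.mpr ⟨hpq, hp⟩)).mul_left _
          have h2 := hnB.isUnit_of_dvd' (Int.natCast_dvd_natCast.mpr hpn) h1
          exact (Nat.prime_iff_prime_int.mp (hP p hp)).not_isUnit h2
      have hrep : ∀ j T : ℕ, (bRep a b c (((q : ℤ) ^ j) ^ 2 * (m * n ^ T) ^ 2) : ℤ) =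
          bRep a b c (((q : ℤ) ^ j * m) ^ 2) * bHprod (bDisc a b c) (n ^ T) := by
        intro j T
        have := hreg (q ^ j * m) (n ^ T) (by have := hq.pos; positivity) (by positivity) ?_ ?_ (hnP T)
        · push_cast at this
          rw [bHprod, ← this]
          congr 2; ring
        · intro p hp hpd
          rcases (Nat.Prime.dvd_mul hp).mp hpd with h1 | h1
          · have := (Nat.prime_dvd_prime_iff_eq hp hq).mp (hp.dvd_of_dvd_pow h1)
            exact Or.inl (this ▸ hqP)
          · exact hmP p hp h1
        · push_cast; exact hnd.pow_left
      have hrep0 : ∀ T : ℕ, (bRep a b c ((m * n ^ T : ℤ) ^ 2) : ℤ) =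
          bRep a b c ((m : ℤ) ^ 2) * bHprod (bDisc a b c) (n ^ T) := by
        intro T
        simpa using hrep 0 T
      have hprim : ∀ T : ℕ,
          ((bPrim a b c q (((q : ℤ) ^ (k + 1)) ^ 2 * (m * n ^ T) ^ 2)).ncard : ℤ) =
          (bRep a b c (((q : ℤ) ^ (k + 1) * m) ^ 2) - bRep a b c (((q : ℤ) ^ k * m) ^ 2)) *
            bHprod (bDisc a b c) (n ^ T) := by
        intro T
        have h1 := hsplit k ((m * n ^ T) ^ 2)
        have h2 := hrep (k + 1) T
        rw [h1] at h2
        push_cast at h2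
        rw [hrep k T] at h2
        linear_combination h2
      have hle : (bRep a b c (((q : ℤ) ^ (k + 1) * m) ^ 2) : ℤ) -
          bRep a b c (((q : ℤ) ^ k * m) ^ 2) ≤ 2 * bRep a b c ((m : ℤ) ^ 2) := by
        refine le_of_forall_mul_bHprod_le (d := bDisc a b c) (n := n) fun T => ?_
        rw [← hprim T, mul_assoc, ← hrep0 (T + 1)]
        have := ncard_bPrim_le h hqp hn0 hN htr ((m * n ^ T) ^ 2)
        rw [show (n : ℤ) ^ 2 * (m * n ^ T) ^ 2 = (m * n ^ (T + 1)) ^ 2 by ring] at this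
        exact_mod_cast this
      have hge : 2 * (bRep a b c ((m : ℤ) ^ 2) : ℤ) ≤
          (bRep a b c (((q : ℤ) ^ (k + 1) * m) ^ 2) : ℤ) -
            bRep a b c (((q : ℤ) ^ k * m) ^ 2) := by
        refine le_of_forall_mul_bHprod_le (d := bDisc a b c) (n := n) fun T => ?_
        rw [← hprim (T + 1), mul_assoc, ← hrep0 T]
        have hqM : ¬ (q : ℤ) ∣ (m * n ^ T : ℤ) ^ 2 := by
          intro h1
          have h1 : q ∣ m * n ^ T := by exact_mod_cast hqp.dvd_of_dvd_pow h1
          rcases hq.dvd_mul.mp h1 with h1 | h1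
          · exact hqm h1
          · exact hqn (hq.dvd_of_dvd_pow h1)
        have := two_mul_bRep_le_ncard_bPrim h hqp hn0 k.succ_ne_zero hN htr hqM
        rw [show (n : ℤ) ^ 2 * (m * n ^ T) ^ 2 = (m * n ^ (T + 1)) ^ 2 by ring] at this
        exact_mod_cast this
      push_cast
      linear_combination le_antisymm hle hge + ih
    · rw [if_neg hχ] at ih ⊢
      have h1 := hsplit k ((m : ℤ) ^ 2)
      rw [bPrim_eq_empty hq hqd hχ _ (((dvd_pow_self _ k.succ_ne_zero).trans
        (dvd_pow_self _ two_ne_zero)).mul_right _), Set.ncard_empty, zero_add] at h1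
      rw [mul_pow, h1, ← mul_pow, ih]

theorem bASSR.erase {a b c : ℤ} {P : Finset ℕ} (h : bPosDef a b c) (hP : ∀ p ∈ P, p.Prime)
    (hreg : bASSR a b c P) {q : ℕ} (hqP : q ∈ P) : bASSR a b c (P.erase q) := by
  intro n₁ n₂ hn₁ hn₂ h1 h2 h3
  have hq := hP q hqP
  have hqp : Prime (q : ℤ) := Nat.prime_iff_prime_int.mp hq
  have h1' : ∀ p : ℕ, p.Prime → p ∣ n₁ → p ∈ P ∨ (p : ℤ) ∣ 2 * bDisc a b c := fun p hp hpn =>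
    (h1 p hp hpn).imp_left Finset.mem_of_mem_erase
  by_cases hqd : (q : ℤ) ∣ 2 * bDisc a b c
  · refine hreg n₁ n₂ hn₁ hn₂ h1' h2 fun p hp hpn => ?_
    by_cases hpq : p = q
    · subst hpq
      exact hqp.not_isUnit (h2.isUnit_of_dvd' (Int.natCast_dvd_natCast.mpr hpn) hqd)
    · exact h3 p (Finset.mem_erase.mpr ⟨hpq, hp⟩) hpn
  · obtain ⟨μ, k, hqk, rfl⟩ := Nat.exists_eq_pow_mul_and_not_dvd hn₂.ne' q hq.ne_one
    have hqn₁ : ¬ q ∣ n₁ := fun h4 => by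
      rcases h1 q hq h4 with h5 | h5
      · exact Finset.notMem_erase q P h5
      · exact hqd h5
    have hk : 0 < k := Nat.pos_of_ne_zero fun h0 => hqk (h0 ▸ dvd_zero q)
    have hkey := hreg.bRep_mul_pow h hP hqP hqd hn₁ h1' hqn₁ μ
    have hcop : Nat.Coprime (q ^ μ) k := ((Nat.Prime.coprime_iff_not_dvd hq).mpr hqk).pow_left μ
    have hmain := hreg (q ^ μ * n₁) k (by have := hq.pos; positivity) hk ?_ ?_ ?_
    · have hprod : ∏ p ∈ (q ^ μ * k).primeFactors,
          bHp (bDisc a b c) p ((q ^ μ * k).factorization p) =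
          bHp (bDisc a b c) q μ * ∏ p ∈ k.primeFactors, bHp (bDisc a b c) p (k.factorization p) := by
        rcases Nat.eq_zero_or_pos μ with rfl | hμ
        · simp [bHp]
        · rw [hcop.primeFactors_mul, Nat.primeFactors_prime_pow hμ.ne' hq,
            Finset.prod_union (by
              rw [Finset.disjoint_singleton_left]
              exact fun h5 => hqk (Nat.dvd_of_mem_primeFactors h5)), Finset.prod_singleton]
          congr 1
          · rw [Nat.factorization_mul (pow_ne_zero _ hq.ne_zero) hk.ne', hq.factorization_pow]
            simp [Nat.factorization_eq_zero_of_not_dvd hqk]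
          · refine Finset.prod_congr rfl fun p hp => ?_
            have hpq : q ≠ p := fun h5 => hqk (h5 ▸ Nat.dvd_of_mem_primeFactors hp)
            rw [Nat.factorization_mul (pow_ne_zero _ hq.ne_zero) hk.ne', hq.factorization_pow]
            simp [hpq]
      rw [hprod]
      push_cast at hmain ⊢
      rw [hkey] at hmain
      rw [show (n₁ : ℤ) * (q ^ μ * k) = q ^ μ * n₁ * k by ring, hmain]
      ring
    · intro p hp hpd
      rcases hp.dvd_mul.mp hpd with h4 | h4
      · exact Or.inl ((Nat.prime_dvd_prime_iff_eq hp hq).mp (hp.dvd_of_dvd_pow h4) ▸ hqP)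
      · exact h1' p hp h4
    · push_cast at h2
      exact h2.of_mul_left_right
    · intro p hp hpk
      by_cases hpq : p = q
      · exact hqk (hpq ▸ hpk)
      · exact h3 p (Finset.mem_erase.mpr ⟨hpq, hp⟩) (hpk.mul_left _)

theorem bASSR.empty {a b c : ℤ} (h : bPosDef a b c) {P : Finset ℕ} (hP : ∀ p ∈ P, p.Prime)
    (hreg : bASSR a b c P) : bASSR a b c ∅ := by
  induction P using Finset.induction_on with
  | empty => exact hreg
  | insert q P hqP ih =>
    refine ih (fun p hp => hP p (Finset.mem_insert_of_mem hp)) ?_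
    have := hreg.erase h hP (Finset.mem_insert_self q P)
    rwa [Finset.erase_insert hqP] at this

/-- A positive definite binary form (representing a nonzero square) is strongly
s-regular iff it is almost strongly s-regular with respect to some finite set of
primes. -/
theorem stmt_7 (a b c : ℤ) (hpos : bPosDef a b c)
    (hsq : ∃ n : ℕ, 0 < n ∧ bRep a b c ((n : ℤ) ^ 2) ≠ 0) :
    bASSR a b c ∅ ↔ ∃ P : Finset ℕ, (∀ p ∈ P, p.Prime) ∧ bASSR a b c P := by
  exact ⟨fun h => ⟨∅, by simp, h⟩, fun ⟨_, hP, h⟩ => h.empty hpos hP⟩
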